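/- Fix antenna numbers N_h, N_v ≥ 1, numbers of subcarriers K_m, K_e ≥ 1, start frequencies f₁ᵐ, f₁ᵉ ∈ ℝ, a subcarrier spacing Δf ≠ 0, and oversampling factors O_h, O_v, O_d ≥ 1. For α ∈ ℂ, ω_h, ω_v, τ ∈ ℝ and a start frequency f₁ and subcarrier count K, define the path response matrix R(α, ω_h, ω_v, τ; f₁, K) ∈ ℂ^{(N_h·N_v) × K} with entries R[(n₁,n₂), k] = α · exp(−2πi f₁ τ) · exp(i (n₁ ω_h + n₂ ω_v)) · exp(−2πi k Δf τ) for n₁ ∈ {0,…,N_h−1}, n₂ ∈ {0,…,N_v−1}, k ∈ {0,…,K−1}. For integers m₁, m₂, m₃, let s = m₃/(O_d K_m Δf), β = 2π (f₁ᵉ − f₁ᵐ) s, and define V(m₁,m₂,m₃) ∈ ℂ^{(N_h·N_v) × K_e} with entries V[(n₁,n₂), k] = exp(i β) · exp(−2πi (m₁ n₁/(O_h N_h) + m₂ n₂/(O_v N_v))) · exp(2πi m₃ k/(O_d K_m)). Then V(m₁,m₂,m₃) ⊙ R(α, ω_h, ω_v, τ; f₁ᵉ, K_e) = R(α·exp(−2πi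 f₁ᵐ s), ω_h − 2π m₁/(O_h N_h), ω_v − 2π m₂/(O_v N_v), τ − s; f₁ᵉ, K_e). -/

import Mathlib

open Matrix

/-- Single-path response matrix of an `N_h × N_v` uniform planar array over `K`
subcarriers with start frequency `f₁` and subcarrier spacing `Δf`:
`R[(n₁,n₂),k] = α·exp(−2πi f₁ τ)·exp(i(n₁ω_h + n₂ω_v))·exp(−2πi k Δf τ)`. -/
noncomputable def pathResp (Nh Nv : ℕ) (Δf : ℝ) (α : ℂ) (ωh ωv τ : ℝ)
    (f₁ : ℝ) (K : ℕ) : Matrix (Fin Nh × Fin Nv) (Fin K) ℂ := fun p k =>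
  α * Complex.exp (((-(2 * Real.pi * f₁ * τ) : ℝ) : ℂ) * Complex.I)
    * Complex.exp ((((p.1.val : ℝ) * ωh + (p.2.val : ℝ) * ωv : ℝ) : ℂ) * Complex.I)
    * Complex.exp (((-(2 * Real.pi * (k.val : ℝ) * Δf * τ) : ℝ) : ℂ) * Complex.I)

/-- Label co-transformation matrix for the target band: the angular-delay
peak-position alignment phases together with the phase-rotation term `exp(iβ)`,
`β = 2π(f₁ᵉ − f₁ᵐ)·m₃/(O_d K_m Δf)`:
`V[(n₁,n₂),k] = exp(iβ)·exp(−2πi(m₁n₁/(O_hN_h)+m₂n₂/(O_vN_v)))·exp(2πi m₃k/(O_dK_m))`. -/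
noncomputable def labelTransform (Nh Nv Km Ke : ℕ) (f₁m f₁e Δf : ℝ)
    (Oh Ov Od : ℕ) (m₁ m₂ m₃ : ℤ) : Matrix (Fin Nh × Fin Nv) (Fin Ke) ℂ := fun p k =>
  Complex.exp (((2 * Real.pi * (f₁e - f₁m) *
        ((m₃ : ℝ) / ((Od : ℝ) * (Km : ℝ) * Δf)) : ℝ) : ℂ) * Complex.I)
    * Complex.exp (((-(2 * Real.pi * ((m₁ : ℝ) * (p.1.val : ℝ) / ((Oh : ℝ) * (Nh : ℝ))
        + (m₂ : ℝ) * (p.2.val : ℝ) / ((Ov : ℝ) * (Nv : ℝ)))) : ℝ) : ℂ) * Complex.I)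
    * Complex.exp (((2 * Real.pi * (m₃ : ℝ) * (k.val : ℝ) / ((Od : ℝ) * (Km : ℝ)) : ℝ) : ℂ)
        * Complex.I)

/-- Proposition 2 (label co-transformation for path alignment), single path:
the co-transformed label equals the target-band response evaluated at exactly
the shifted path parameters produced by the measured-band path alignment. -/
theorem stmt_13 (Nh Nv Km Ke : ℕ) (hNh : 1 ≤ Nh) (hNv : 1 ≤ Nv)
    (hKm : 1 ≤ Km) (hKe : 1 ≤ Ke) (f₁m f₁e Δf : ℝ) (hΔf : Δf ≠ 0)
    (Oh Ov Od : ℕ) (hOh : 1 ≤ Oh) (hOv : 1 ≤ Ov) (hOd : 1 ≤ Od)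
    (α : ℂ) (ωh ωv τ : ℝ) (m₁ m₂ m₃ : ℤ) :
    labelTransform Nh Nv Km Ke f₁m f₁e Δf Oh Ov Od m₁ m₂ m₃ ⊙
        pathResp Nh Nv Δf α ωh ωv τ f₁e Ke =
      pathResp Nh Nv Δf
        (α * Complex.exp (((-(2 * Real.pi * f₁m *
            ((m₃ : ℝ) / ((Od : ℝ) * (Km : ℝ) * Δf))) : ℝ) : ℂ) * Complex.I))
        (ωh - 2 * Real.pi * (m₁ : ℝ) / ((Oh : ℝ) * (Nh : ℝ)))
        (ωv - 2 * Real.pi * (m₂ : ℝ) / ((Ov : ℝ) * (Nv : ℝ)))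
        (τ - (m₃ : ℝ) / ((Od : ℝ) * (Km : ℝ) * Δf)) f₁e Ke := by
  have hOd' : (Od : ℂ) ≠ 0 := Nat.cast_ne_zero.mpr (by lia)
  have hKm' : (Km : ℂ) ≠ 0 := Nat.cast_ne_zero.mpr (by lia)
  have hΔf' : (Δf : ℂ) ≠ 0 := Complex.ofReal_ne_zero.mpr hΔf
  have gather (a b c d e f : ℂ) :
      Complex.exp a * Complex.exp b * Complex.exp c *
          (α * Complex.exp d * Complex.exp e * Complex.exp f) =
        α * Complex.exp (a + b + c + d + e + f) := by
    simp only [Complex.exp_add]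
    ring
  have gather_shifted (a b c d : ℂ) :
      α * Complex.exp a * Complex.exp b * Complex.exp c * Complex.exp d =
        α * Complex.exp (a + b + c + d) := by
    simp only [Complex.exp_add]
    ring
  ext p k
  simp only [Matrix.hadamard_apply, labelTransform, pathResp]
  rw [gather, gather_shifted]
  congr 2
  have delay_phase : (k.val : ℂ) * Δf * ((m₃ : ℂ) / ((Od : ℂ) * (Km : ℂ) * Δf)) =
      (m₃ : ℂ) * (k.val : ℂ) / ((Od : ℂ) * (Km : ℂ)) := by
    field_simp
  push_cast
  linear_combination (-(2 * (Real.pi : ℂ) * Complex.I)) * delay_phase
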